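/- Let A = 𝕜[x] and B = 𝕜[y] be free algebras on one generator and τ: B⊗A → A⊗B a graded twisting map with τ(y⊗x) = a x²⊗1 + b x⊗y + c 1⊗y² for scalars a, b, c ∈ 𝕜. For d ≥ 2 and 1 ≤ i ≤ d−1, let s_i^d denote the coefficient of 1⊗y^d when τ(y^i⊗x^{d−i}) is written in the basis {x^p⊗y^q}. If 1 − ac ≠ 0, then 1 − a·s_{d−1}^d ≠ 0 for all d ≥ 2. -/

import Mathlib

open TensorProduct

noncomputable section

namespace TTP

variable (𝕜 : Type) [Field 𝕜]

/-- The image of `p ⊗ q` inside `M ⊗[𝕜] N`, for submodules `p ⊆ M`, `q ⊆ N`. -/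
def subTmul {M N : Type} [AddCommGroup M] [Module 𝕜 M] [AddCommGroup N] [Module 𝕜 N]
    (p : Submodule 𝕜 M) (q : Submodule 𝕜 N) : Submodule 𝕜 (M ⊗[𝕜] N) :=
  LinearMap.range (TensorProduct.map p.subtype q.subtype)

/-- The Künneth grading on a tensor product of graded vector spaces. -/
def kunneth {M N : Type} [AddCommGroup M] [Module 𝕜 M] [AddCommGroup N] [Module 𝕜 N]
    (𝒜 : ℕ → Submodule 𝕜 M) (ℬ : ℕ → Submodule 𝕜 N) (n : ℕ) : Submodule 𝕜 (M ⊗[𝕜] N) :=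
  ⨆ (pq : ℕ × ℕ) (_ : pq.1 + pq.2 = n), subTmul 𝕜 (𝒜 pq.1) (ℬ pq.2)

/-- The positive part `X₊ = ⊕_{i>0} X_i` of a graded vector space. -/
def plusPart {M : Type} [AddCommGroup M] [Module 𝕜 M] (𝒜 : ℕ → Submodule 𝕜 M) :
    Submodule 𝕜 M :=
  ⨆ (i : ℕ) (_ : 0 < i), 𝒜 i

/-- The grading concentrating `𝒜 1` in degree `1` (and `⊥` elsewhere). -/
def degOne {M : Type} [AddCommGroup M] [Module 𝕜 M] (𝒜 : ℕ → Submodule 𝕜 M) :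
    ℕ → Submodule 𝕜 M :=
  fun n => if n = 1 then 𝒜 1 else ⊥

variable (A B : Type) [Ring A] [Algebra 𝕜 A] [Ring B] [Algebra 𝕜 B]

/-- `τ ∘ (μ_B ⊗ μ_A)` on `(B ⊗ B) ⊗ (A ⊗ A)`. -/
def twistLHS (τ : B ⊗[𝕜] A →ₗ[𝕜] A ⊗[𝕜] B) :
    (B ⊗[𝕜] B) ⊗[𝕜] (A ⊗[𝕜] A) →ₗ[𝕜] A ⊗[𝕜] B :=
  τ ∘ₗ TensorProduct.map (LinearMap.mul' 𝕜 B) (LinearMap.mul' 𝕜 A)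

/-- `(μ_A ⊗ μ_B) ∘ (1_A ⊗ τ ⊗ 1_B) ∘ (τ ⊗ τ) ∘ (1_B ⊗ τ ⊗ 1_A)` on `(B ⊗ B) ⊗ (A ⊗ A)`. -/
def twistRHS (τ : B ⊗[𝕜] A →ₗ[𝕜] A ⊗[𝕜] B) :
    (B ⊗[𝕜] B) ⊗[𝕜] (A ⊗[𝕜] A) →ₗ[𝕜] A ⊗[𝕜] B :=
  TensorProduct.map (LinearMap.mul' 𝕜 A) (LinearMap.mul' 𝕜 B)
    ∘ₗ (TensorProduct.assoc 𝕜 A A (B ⊗[𝕜] B)).symm.toLinearMap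
    ∘ₗ LinearMap.lTensor A (TensorProduct.assoc 𝕜 A B B).toLinearMap
    ∘ₗ LinearMap.lTensor A (LinearMap.rTensor B τ)
    ∘ₗ LinearMap.lTensor A (TensorProduct.assoc 𝕜 B A B).symm.toLinearMap
    ∘ₗ (TensorProduct.assoc 𝕜 A B (A ⊗[𝕜] B)).toLinearMap
    ∘ₗ TensorProduct.map τ τ
    ∘ₗ (TensorProduct.assoc 𝕜 B A (B ⊗[𝕜] A)).symm.toLinearMap
    ∘ₗ LinearMap.lTensor B (TensorProduct.assoc 𝕜 A B A).toLinearMap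
    ∘ₗ LinearMap.lTensor B (LinearMap.rTensor A τ)
    ∘ₗ LinearMap.lTensor B (TensorProduct.assoc 𝕜 B A A).symm.toLinearMap
    ∘ₗ (TensorProduct.assoc 𝕜 B B (A ⊗[𝕜] A)).toLinearMap

/-- `τ : B ⊗ A → A ⊗ B` is an (algebra) twisting map: it satisfies the unital twisting
conditions and `τ(μ_B ⊗ μ_A) = (μ_A ⊗ μ_B)(1_A ⊗ τ ⊗ 1_B)(τ ⊗ τ)(1_B ⊗ τ ⊗ 1_A)`. -/
def IsTwisting (τ : B ⊗[𝕜] A →ₗ[𝕜] A ⊗[𝕜] B) : Prop :=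
  (∀ a : A, τ ((1 : B) ⊗ₜ[𝕜] a) = a ⊗ₜ[𝕜] (1 : B)) ∧
  (∀ b : B, τ (b ⊗ₜ[𝕜] (1 : A)) = (1 : A) ⊗ₜ[𝕜] b) ∧
  twistLHS 𝕜 A B τ = twistRHS 𝕜 A B τ

/-- `τ` preserves the Künneth grading. -/
def IsGradedMapBA (𝒜 : ℕ → Submodule 𝕜 A) (ℬ : ℕ → Submodule 𝕜 B)
    (τ : B ⊗[𝕜] A →ₗ[𝕜] A ⊗[𝕜] B) : Prop :=
  ∀ n, Submodule.map τ (kunneth 𝕜 ℬ 𝒜 n) ≤ kunneth 𝕜 𝒜 ℬ n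

/-- `τ` is a graded twisting map. -/
def IsGradedTwisting (𝒜 : ℕ → Submodule 𝕜 A) (ℬ : ℕ → Submodule 𝕜 B)
    (τ : B ⊗[𝕜] A →ₗ[𝕜] A ⊗[𝕜] B) : Prop :=
  IsTwisting 𝕜 A B τ ∧ IsGradedMapBA 𝕜 A B 𝒜 ℬ τ

/-- A graded linear map `τ` is graded twisting to degree `n`:  it satisfies the unital
conditions and the twisting identity in all (Künneth) degrees `≤ n`. -/
def TwistingToDeg (𝒜 : ℕ → Submodule 𝕜 A) (ℬ : ℕ → Submodule 𝕜 B)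
    (τ : B ⊗[𝕜] A →ₗ[𝕜] A ⊗[𝕜] B) (n : ℕ) : Prop :=
  IsGradedMapBA 𝕜 A B 𝒜 ℬ τ ∧
  (∀ j ≤ n, ∀ a ∈ 𝒜 j, τ ((1 : B) ⊗ₜ[𝕜] a) = a ⊗ₜ[𝕜] (1 : B)) ∧
  (∀ j ≤ n, ∀ b ∈ ℬ j, τ (b ⊗ₜ[𝕜] (1 : A)) = (1 : A) ⊗ₜ[𝕜] b) ∧
  (∀ j ≤ n, ∀ x ∈ kunneth 𝕜 (kunneth 𝕜 ℬ ℬ) (kunneth 𝕜 𝒜 𝒜) j,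
    twistLHS 𝕜 A B τ x = twistRHS 𝕜 A B τ x)

/-- The unique extension property of a graded twisting map:  for every `n ≥ 3`, any
linear map `τ'` that is graded twisting to degree `n` and agrees with `τ` in all degrees
`< n` also agrees with `τ` in degree `n`. -/
def UEP (𝒜 : ℕ → Submodule 𝕜 A) (ℬ : ℕ → Submodule 𝕜 B)
    (τ : B ⊗[𝕜] A →ₗ[𝕜] A ⊗[𝕜] B) : Prop :=
  ∀ n, 3 ≤ n → ∀ τ' : B ⊗[𝕜] A →ₗ[𝕜] A ⊗[𝕜] B,
    TwistingToDeg 𝕜 A B 𝒜 ℬ τ' n →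
    (∀ i < n, ∀ x ∈ kunneth 𝕜 ℬ 𝒜 i, τ' x = τ x) →
    ∀ x ∈ kunneth 𝕜 ℬ 𝒜 n, τ' x = τ x

/-- The multiplication `μ_τ = (μ_A ⊗ μ_B)(1_A ⊗ τ ⊗ 1_B)` on `A ⊗ B`. -/
def mulTau (τ : B ⊗[𝕜] A →ₗ[𝕜] A ⊗[𝕜] B) :
    (A ⊗[𝕜] B) ⊗[𝕜] (A ⊗[𝕜] B) →ₗ[𝕜] A ⊗[𝕜] B :=
  TensorProduct.map (LinearMap.mul' 𝕜 A) (LinearMap.mul' 𝕜 B)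
    ∘ₗ (TensorProduct.assoc 𝕜 A A (B ⊗[𝕜] B)).symm.toLinearMap
    ∘ₗ LinearMap.lTensor A (TensorProduct.assoc 𝕜 A B B).toLinearMap
    ∘ₗ LinearMap.lTensor A (LinearMap.rTensor B τ)
    ∘ₗ LinearMap.lTensor A (TensorProduct.assoc 𝕜 B A B).symm.toLinearMap
    ∘ₗ (TensorProduct.assoc 𝕜 A B (A ⊗[𝕜] B)).toLinearMap

/-- `(C, ψ)` realizes the twisted tensor product algebra `A ⊗_τ B`:  `ψ` is a linear
isomorphism carrying the multiplication `μ_τ` and its unit to those of `C`. -/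
def Realizes (τ : B ⊗[𝕜] A →ₗ[𝕜] A ⊗[𝕜] B) (C : Type) [Ring C] [Algebra 𝕜 C]
    (ψ : A ⊗[𝕜] B →ₗ[𝕜] C) : Prop :=
  Function.Bijective ψ ∧ ψ ((1 : A) ⊗ₜ[𝕜] (1 : B)) = 1 ∧
  ∀ x y : A ⊗[𝕜] B, ψ (mulTau 𝕜 A B τ (x ⊗ₜ[𝕜] y)) = ψ x * ψ y

/-- The two-sided ideal generated by a subset, as a `𝕜`-submodule. -/
def idealSpan (C : Type) [Ring C] [Algebra 𝕜 C] (s : Set C) : Submodule 𝕜 C :=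
  Submodule.span 𝕜 {x | ∃ c d r, r ∈ s ∧ x = c * r * d}

/-- Weight grading of the tensor algebra. -/
def tensorWeight (V : Type) [AddCommGroup V] [Module 𝕜 V] (n : ℕ) :
    Submodule 𝕜 (TensorAlgebra 𝕜 V) :=
  LinearMap.range (TensorAlgebra.ι 𝕜 (M := V)) ^ n

instance (V : Type) [AddCommGroup V] [Module 𝕜 V] : GradedAlgebra (tensorWeight 𝕜 V) :=
  inferInstanceAs (GradedAlgebra
    ((LinearMap.range (TensorAlgebra.ι 𝕜 : V →ₗ[𝕜] TensorAlgebra 𝕜 V) ^ ·) : ℕ → Submodule 𝕜 _))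

/-- The canonical map `T(C₁) → C` for a graded algebra `C`. -/
def canMap (C : Type) [Ring C] [Algebra 𝕜 C] (𝒞 : ℕ → Submodule 𝕜 C) :
    TensorAlgebra 𝕜 ↥(𝒞 1) →ₐ[𝕜] C :=
  TensorAlgebra.lift 𝕜 (𝒞 1).subtype

/-- `C` (with grading `𝒞`) is a quadratic algebra: the canonical map `T(C₁) → C` is
surjective and its kernel is generated, as a two-sided ideal, by its degree 2 part. -/
def IsQuadraticAlg (C : Type) [Ring C] [Algebra 𝕜 C] (𝒞 : ℕ → Submodule 𝕜 C) : Prop :=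
  Function.Surjective (canMap 𝕜 C 𝒞) ∧
  LinearMap.ker (canMap 𝕜 C 𝒞).toLinearMap =
    idealSpan 𝕜 (TensorAlgebra 𝕜 ↥(𝒞 1))
      ((LinearMap.ker (canMap 𝕜 C 𝒞).toLinearMap ⊓ tensorWeight 𝕜 ↥(𝒞 1) 2 : Submodule 𝕜 _) : Set _)

/-- The left ideal generated by the positive part of a graded algebra. -/
def augIdeal (C : Type) [Ring C] [Algebra 𝕜 C] (𝒞 : ℕ → Submodule 𝕜 C) : Submodule C C :=
  Submodule.span C {x : C | ∃ i, 0 < i ∧ x ∈ 𝒞 i}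

/-- The degree `n` component of the graded free module on generators `σ` in degree `i`. -/
def freeGrade (C : Type) [Ring C] [Algebra 𝕜 C] (𝒞 : ℕ → Submodule 𝕜 C)
    (i : ℕ) (σ : Type) (n : ℕ) : Submodule 𝕜 (σ →₀ C) :=
  ⨅ (j : σ), Submodule.comap (Finsupp.lapply j : (σ →₀ C) →ₗ[𝕜] C)
    (if i ≤ n then 𝒞 (n - i) else ⊥)

/-- `C` (with grading `𝒞`) is a Koszul algebra: the trivial module `𝕜 = C/C₊` admits a
resolution by graded free modules with the `i`-th term generated in degree `i`. -/
def IsKoszul (C : Type) [Ring C] [Algebra 𝕜 C] (𝒞 : ℕ → Submodule 𝕜 C) : Prop :=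
  ∃ (σ : ℕ → Type) (d : ∀ i : ℕ, ((σ (i + 1)) →₀ C) →ₗ[C] ((σ i) →₀ C))
    (ε : ((σ 0) →₀ C) →ₗ[C] (C ⧸ augIdeal 𝕜 C 𝒞)),
    Function.Surjective ε ∧
    LinearMap.ker ε = LinearMap.range (d 0) ∧
    (∀ i, LinearMap.ker (d i) = LinearMap.range (d (i + 1))) ∧
    (∀ i n, ∀ x ∈ freeGrade 𝕜 C 𝒞 (i + 1) (σ (i + 1)) n, d i x ∈ freeGrade 𝕜 C 𝒞 i (σ i) n) ∧
    (∀ n, 0 < n → ∀ x ∈ freeGrade 𝕜 C 𝒞 0 (σ 0) n, ε x = 0)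

/-- `(P, ιA, ιB)` is a free product (coproduct) of `A` and `B`. -/
def IsFreeProduct (P : Type) [Ring P] [Algebra 𝕜 P] (ιA : A →ₐ[𝕜] P) (ιB : B →ₐ[𝕜] P) :
    Prop :=
  ∀ (C : Type) [Ring C] [Algebra 𝕜 C], ∀ (f : A →ₐ[𝕜] C) (g : B →ₐ[𝕜] C),
    ∃! h : P →ₐ[𝕜] C, h.comp ιA = f ∧ h.comp ιB = g

/-- The linear map `A ⊗ B → P`, `a ⊗ b ↦ ιA(a) · ιB(b)`. -/
def mulMapP (P : Type) [Ring P] [Algebra 𝕜 P] (ιA : A →ₐ[𝕜] P) (ιB : B →ₐ[𝕜] P) :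
    A ⊗[𝕜] B →ₗ[𝕜] P :=
  TensorProduct.lift (LinearMap.mk₂ 𝕜 (fun a b => ιA a * ιB b)
    (fun a a' b => by simp [map_add, add_mul])
    (fun c a b => by simp [map_smul, smul_mul_assoc])
    (fun a b b' => by simp [map_add, mul_add])
    (fun c a b => by simp [map_smul, mul_smul_comm]))

/-- The set of `τ`-relations `b ⊗ a - τ(b ⊗ a)` of total degree at most `n`,
inside the free product `P`. -/
def relSetLe (P : Type) [Ring P] [Algebra 𝕜 P] (ιA : A →ₐ[𝕜] P) (ιB : B →ₐ[𝕜] P)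
    (𝒜 : ℕ → Submodule 𝕜 A) (ℬ : ℕ → Submodule 𝕜 B)
    (τ : B ⊗[𝕜] A →ₗ[𝕜] A ⊗[𝕜] B) (n : ℕ) : Set P :=
  {x | ∃ i j a b, i + j ≤ n ∧ a ∈ 𝒜 i ∧ b ∈ ℬ j ∧
    x = ιB b * ιA a - mulMapP 𝕜 A B P ιA ιB (τ (b ⊗ₜ[𝕜] a))}

/-- The set of all `τ`-relations `b ⊗ a - τ(b ⊗ a)` inside the free product `P`. -/
def relSetAll (P : Type) [Ring P] [Algebra 𝕜 P] (ιA : A →ₐ[𝕜] P) (ιB : B →ₐ[𝕜] P)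
    (τ : B ⊗[𝕜] A →ₗ[𝕜] A ⊗[𝕜] B) : Set P :=
  {x | ∃ a b, x = ιB b * ιA a - mulMapP 𝕜 A B P ιA ιB (τ (b ⊗ₜ[𝕜] a))}

/-- The (Künneth) grading on the free product `P` of the graded algebras `A` and `B`. -/
def freeProdGrade (P : Type) [Ring P] [Algebra 𝕜 P] (ιA : A →ₐ[𝕜] P) (ιB : B →ₐ[𝕜] P)
    (𝒜 : ℕ → Submodule 𝕜 A) (ℬ : ℕ → Submodule 𝕜 B) (n : ℕ) : Submodule 𝕜 P :=
  ⨆ (l : List ℕ) (_ : l.sum = n),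
    ((l.map (fun i => Submodule.map ιA.toLinearMap (𝒜 i) ⊔ Submodule.map ιB.toLinearMap (ℬ i))).foldr
      (· * ·) 1)

end TTP

namespace TTP

open Polynomial

/-- The grading of `𝕜[x]` by degree: the degree `n` component is spanned by `x^n`. -/
def polyGrade (𝕜 : Type) [Field 𝕜] : ℕ → Submodule 𝕜 (Polynomial 𝕜) :=
  fun n => Submodule.span 𝕜 {(X : Polynomial 𝕜) ^ n}

/-- The coefficient of the basis vector `x^p ⊗ y^q` of `𝕜[x] ⊗ 𝕜[y]`. -/
def coefAB (𝕜 : Type) [Field 𝕜] (p q : ℕ) :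
    (Polynomial 𝕜) ⊗[𝕜] (Polynomial 𝕜) →ₗ[𝕜] 𝕜 :=
  (TensorProduct.lid 𝕜 𝕜).toLinearMap ∘ₗ TensorProduct.map (lcoeff 𝕜 p) (lcoeff 𝕜 q)

section TwistingCalculus

variable {𝕜 : Type} [Field 𝕜] {A B : Type} [Ring A] [Algebra 𝕜 A] [Ring B] [Algebra 𝕜 B]
  {τ : B ⊗[𝕜] A →ₗ[𝕜] A ⊗[𝕜] B}

theorem mulTau_tmul (a a' : A) (b b' : B) :
    mulTau 𝕜 A B τ ((a ⊗ₜ[𝕜] b) ⊗ₜ[𝕜] (a' ⊗ₜ[𝕜] b')) =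
      (a ⊗ₜ[𝕜] 1) * τ (b ⊗ₜ[𝕜] a') * (1 ⊗ₜ[𝕜] b') := by
  simp only [mulTau, LinearMap.comp_apply, LinearEquiv.coe_coe, TensorProduct.assoc_tmul,
    LinearMap.lTensor_tmul, TensorProduct.assoc_symm_tmul, LinearMap.rTensor_tmul]
  induction τ (b ⊗ₜ[𝕜] a') with
  | zero => simp
  | add z w hz hw => simp only [add_tmul, tmul_add, map_add, mul_add, add_mul, hz, hw]
  | tmul p q => simp

theorem mulTau_one_tmul_right (hB : ∀ b : B, τ (b ⊗ₜ[𝕜] (1 : A)) = (1 : A) ⊗ₜ[𝕜] b)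
    (z : A ⊗[𝕜] B) (b : B) :
    mulTau 𝕜 A B τ (z ⊗ₜ[𝕜] ((1 : A) ⊗ₜ[𝕜] b)) = z * (1 ⊗ₜ[𝕜] b) := by
  induction z with
  | zero => simp
  | add z w hz hw => simp only [add_tmul, map_add, add_mul, hz, hw]
  | tmul p q => simp [mulTau_tmul, hB]

theorem mulTau_tmul_one_left (hA : ∀ a : A, τ ((1 : B) ⊗ₜ[𝕜] a) = a ⊗ₜ[𝕜] (1 : B))
    (a : A) (z : A ⊗[𝕜] B) :
    mulTau 𝕜 A B τ ((a ⊗ₜ[𝕜] (1 : B)) ⊗ₜ[𝕜] z) = (a ⊗ₜ[𝕜] 1) * z := by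
  induction z with
  | zero => simp
  | add z w hz hw => simp only [tmul_add, map_add, mul_add, hz, hw]
  | tmul p q => simp [mulTau_tmul, hA]

theorem IsTwisting.map_mul_tmul_mul (hτ : IsTwisting 𝕜 A B τ) (b b' : B) (a a' : A) :
    τ ((b * b') ⊗ₜ[𝕜] (a * a')) =
      mulTau 𝕜 A B τ (TensorProduct.map τ τ ((TensorProduct.assoc 𝕜 B A (B ⊗[𝕜] A)).symm
        (b ⊗ₜ[𝕜] TensorProduct.assoc 𝕜 A B A (τ (b' ⊗ₜ[𝕜] a) ⊗ₜ[𝕜] a')))) := by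
  have h := LinearMap.congr_fun hτ.2.2 ((b ⊗ₜ[𝕜] b') ⊗ₜ[𝕜] (a ⊗ₜ[𝕜] a'))
  simpa [twistLHS, twistRHS, mulTau] using h

/-- The operator `a' ⊗ b' ↦ τ(b ⊗ a') (1 ⊗ b')`, which computes `τ((b * -) ⊗ -)` from `τ`. -/
def twistLeft (τ : B ⊗[𝕜] A →ₗ[𝕜] A ⊗[𝕜] B) (b : B) : A ⊗[𝕜] B →ₗ[𝕜] A ⊗[𝕜] B :=
  TensorProduct.lift ((LinearMap.mul 𝕜 (A ⊗[𝕜] B)).compl₁₂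
    (τ ∘ₗ TensorProduct.mk 𝕜 B A b) (TensorProduct.mk 𝕜 A B 1))

/-- The operator `a' ⊗ b' ↦ (a' ⊗ 1) τ(b' ⊗ a)`, which computes `τ(- ⊗ (- * a))` from `τ`. -/
def twistRight (τ : B ⊗[𝕜] A →ₗ[𝕜] A ⊗[𝕜] B) (a : A) : A ⊗[𝕜] B →ₗ[𝕜] A ⊗[𝕜] B :=
  TensorProduct.lift ((LinearMap.mul 𝕜 (A ⊗[𝕜] B)).compl₁₂
    ((TensorProduct.mk 𝕜 A B).flip 1) (τ ∘ₗ (TensorProduct.mk 𝕜 B A).flip a))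

@[simp]
theorem twistLeft_tmul (b : B) (a' : A) (b' : B) :
    twistLeft τ b (a' ⊗ₜ[𝕜] b') = τ (b ⊗ₜ[𝕜] a') * (1 ⊗ₜ[𝕜] b') := by
  simp [twistLeft]

@[simp]
theorem twistRight_tmul (a a' : A) (b' : B) :
    twistRight τ a (a' ⊗ₜ[𝕜] b') = (a' ⊗ₜ[𝕜] 1) * τ (b' ⊗ₜ[𝕜] a) := by
  simp [twistRight]

theorem IsTwisting.map_mul_tmul (hτ : IsTwisting 𝕜 A B τ) (b b' : B) (a : A) :
    τ ((b * b') ⊗ₜ[𝕜] a) = twistLeft τ b (τ (b' ⊗ₜ[𝕜] a)) := by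
  have h := hτ.map_mul_tmul_mul b b' a 1
  rw [mul_one] at h
  rw [h]
  induction τ (b' ⊗ₜ[𝕜] a) with
  | zero => simp
  | add z w hz hw => simp only [add_tmul, tmul_add, map_add, hz, hw]
  | tmul p q => simp [hτ.2.1, mulTau_one_tmul_right hτ.2.1]

theorem IsTwisting.map_tmul_mul (hτ : IsTwisting 𝕜 A B τ) (b : B) (a a' : A) :
    τ (b ⊗ₜ[𝕜] (a * a')) = twistRight τ a' (τ (b ⊗ₜ[𝕜] a)) := by
  have h := hτ.map_mul_tmul_mul 1 b a a'
  rw [one_mul] at h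
  rw [h]
  induction τ (b ⊗ₜ[𝕜] a) with
  | zero => simp
  | add z w hz hw => simp only [add_tmul, tmul_add, map_add, hz, hw]
  | tmul p q => simp [hτ.1, mulTau_tmul_one_left hτ.1]

end TwistingCalculus

section Coefficients

variable {𝕜 : Type} [Field 𝕜]

@[simp]
theorem coefAB_tmul (p q : ℕ) (f g : Polynomial 𝕜) :
    coefAB 𝕜 p q (f ⊗ₜ[𝕜] g) = f.coeff p * g.coeff q := by
  simp [coefAB]

theorem coefAB_mul_one_tmul_X_pow (p n m : ℕ) (z : Polynomial 𝕜 ⊗[𝕜] Polynomial 𝕜) :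
    coefAB 𝕜 p (n + m) (z * (1 ⊗ₜ[𝕜] X ^ m)) = coefAB 𝕜 p n z := by
  induction z with
  | zero => simp
  | add z w hz hw => simp only [map_add, add_mul, hz, hw]
  | tmul f g => simp [coeff_mul_X_pow]

theorem coefAB_zero_tmul_one_mul (n : ℕ) (f : Polynomial 𝕜)
    (z : Polynomial 𝕜 ⊗[𝕜] Polynomial 𝕜) :
    coefAB 𝕜 0 n ((f ⊗ₜ[𝕜] 1) * z) = f.coeff 0 * coefAB 𝕜 0 n z := by
  induction z with
  | zero => simp
  | add z w hz hw => simp only [map_add, mul_add, hz, hw]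
  | tmul f g => simp [mul_coeff_zero, mul_assoc]

theorem tmul_X_pow_mem_kunneth (p q : ℕ) :
    (X ^ p : Polynomial 𝕜) ⊗ₜ[𝕜] (X ^ q : Polynomial 𝕜) ∈
      kunneth 𝕜 (polyGrade 𝕜) (polyGrade 𝕜) (p + q) :=
  Submodule.mem_iSup_of_mem (p, q) <| Submodule.mem_iSup_of_mem rfl
    ⟨⟨X ^ p, Submodule.mem_span_singleton_self _⟩ ⊗ₜ ⟨X ^ q, Submodule.mem_span_singleton_self _⟩,
      by simp⟩

theorem kunneth_polyGrade_le {m : ℕ} {S : Submodule 𝕜 (Polynomial 𝕜 ⊗[𝕜] Polynomial 𝕜)}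
    (hS : ∀ p q, p + q = m → (X ^ p : Polynomial 𝕜) ⊗ₜ[𝕜] (X ^ q : Polynomial 𝕜) ∈ S) :
    kunneth 𝕜 (polyGrade 𝕜) (polyGrade 𝕜) m ≤ S := by
  refine iSup₂_le fun pq hpq => ?_
  rintro _ ⟨z, rfl⟩
  induction z with
  | zero => simp
  | add z w hz hw => simpa only [map_add] using S.add_mem hz hw
  | tmul f g =>
    obtain ⟨f, hf⟩ := f
    obtain ⟨g, hg⟩ := g
    obtain ⟨s, rfl⟩ := Submodule.mem_span_singleton.1 hf
    obtain ⟨t, rfl⟩ := Submodule.mem_span_singleton.1 hg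
    simpa only [map_tmul, Submodule.subtype_apply, smul_tmul_smul] using
      S.smul_mem _ (hS _ _ hpq)

variable {τ : Polynomial 𝕜 ⊗[𝕜] Polynomial 𝕜 →ₗ[𝕜] Polynomial 𝕜 ⊗[𝕜] Polynomial 𝕜}

theorem coefAB_twistRight {m : ℕ} (n : ℕ) (f : Polynomial 𝕜)
    {z : Polynomial 𝕜 ⊗[𝕜] Polynomial 𝕜}
    (hz : z ∈ kunneth 𝕜 (polyGrade 𝕜) (polyGrade 𝕜) m) :
    coefAB 𝕜 0 n (twistRight τ f z) = coefAB 𝕜 0 m z * coefAB 𝕜 0 n (τ ((X ^ m) ⊗ₜ[𝕜] f)) := by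
  refine kunneth_polyGrade_le (S := LinearMap.eqLocus (coefAB 𝕜 0 n ∘ₗ twistRight τ f)
    ((LinearMap.mulRight 𝕜 (coefAB 𝕜 0 n (τ ((X ^ m) ⊗ₜ[𝕜] f)))) ∘ₗ coefAB 𝕜 0 m))
    (fun p q hpq => ?_) hz
  rcases Nat.eq_zero_or_pos p with rfl | hp
  · obtain rfl : q = m := by omega
    simp [coefAB_zero_tmul_one_mul]
  · simp [coefAB_zero_tmul_one_mul, coeff_X_pow, hp.ne]

/-- The relation `yx = a x² + b xy + c y²` applied to the right module `C / xC`, where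
`C = A ⊗_τ B`. -/
theorem coefAB_succ {a b c : 𝕜}
    (hτ : IsGradedTwisting 𝕜 (Polynomial 𝕜) (Polynomial 𝕜) (polyGrade 𝕜) (polyGrade 𝕜) τ)
    (hyx : τ ((X : Polynomial 𝕜) ⊗ₜ[𝕜] (X : Polynomial 𝕜)) =
      a • (((X : Polynomial 𝕜) ^ 2) ⊗ₜ[𝕜] (1 : Polynomial 𝕜)) +
      b • ((X : Polynomial 𝕜) ⊗ₜ[𝕜] (X : Polynomial 𝕜)) +
      c • ((1 : Polynomial 𝕜) ⊗ₜ[𝕜] ((X : Polynomial 𝕜) ^ 2))) (q : ℕ) :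
    coefAB 𝕜 0 (q + 2) (τ ((X ^ (q + 1)) ⊗ₜ[𝕜] X)) *
        (1 - a * coefAB 𝕜 0 (q + 1) (τ ((X ^ q) ⊗ₜ[𝕜] X))) =
      b * coefAB 𝕜 0 (q + 1) (τ ((X ^ q) ⊗ₜ[𝕜] X)) + c := by
  have hmem : τ ((X ^ q) ⊗ₜ[𝕜] X) ∈ kunneth 𝕜 (polyGrade 𝕜) (polyGrade 𝕜) (q + 1) :=
    hτ.2 (q + 1) ⟨_, by simpa using tmul_X_pow_mem_kunneth (𝕜 := 𝕜) q 1, rfl⟩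
  have hsq : coefAB 𝕜 0 (q + 2) (τ ((X ^ q) ⊗ₜ[𝕜] (X ^ 2))) =
      coefAB 𝕜 0 (q + 1) (τ ((X ^ q) ⊗ₜ[𝕜] X)) *
        coefAB 𝕜 0 (q + 2) (τ ((X ^ (q + 1)) ⊗ₜ[𝕜] X)) := by
    rw [pow_two (X : Polynomial 𝕜), hτ.1.map_tmul_mul, coefAB_twistRight _ _ hmem]
  have hmul : τ ((X ^ (q + 1)) ⊗ₜ[𝕜] X) =
      a • τ ((X ^ q) ⊗ₜ[𝕜] (X ^ 2)) + b • (τ ((X ^ q) ⊗ₜ[𝕜] X) * (1 ⊗ₜ[𝕜] X)) +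
        c • ((1 : Polynomial 𝕜) ⊗ₜ[𝕜] (X ^ (q + 2) : Polynomial 𝕜)) := by
    rw [pow_succ (X : Polynomial 𝕜) q, hτ.1.map_mul_tmul, hyx]
    simp [hτ.1.2.1, pow_add, ← Algebra.TensorProduct.one_def]
  have hshift := coefAB_mul_one_tmul_X_pow 0 (q + 1) 1 (τ ((X ^ q) ⊗ₜ[𝕜] X))
  rw [pow_one] at hshift
  have hcoef := congrArg (coefAB 𝕜 0 (q + 2)) hmul
  simp only [map_add, map_smul, smul_eq_mul, hsq, hshift, coefAB_tmul, coeff_one_zero,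
    coeff_X_pow_self, mul_one] at hcoef
  linear_combination hcoef

end Coefficients

/-- If a sequence with `s 0 = c` satisfies `s (n + 1) * (1 - a * s n) = b * s n + c`, then
`a * s n` never equals `1`, provided `a * c ≠ 1`. -/
theorem one_sub_mul_ne_zero_of_rec {𝕜 : Type} [Field 𝕜] {a b c : 𝕜} {s : ℕ → 𝕜} (h0 : s 0 = c)
    (hs : ∀ n, s (n + 1) * (1 - a * s n) = b * s n + c) (h : 1 - a * c ≠ 0) (n : ℕ) :
    1 - a * s n ≠ 0 := by
  by_cases hbc : b + a * c = 0
  · suffices hconst : ∀ n, s n = c by rwa [hconst n]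
    intro n
    induction n with
    | zero => exact h0
    | succ n ih =>
      refine mul_right_cancel₀ h ?_
      have := hs n
      rw [ih] at this
      linear_combination this + c * hbc
  · intro hn
    refine hbc ?_
    linear_combination a * s (n + 1) * hn - a * hs n + b * hn

/-- Let `A = 𝕜[x]`, `B = 𝕜[y]` and let `τ : B ⊗ A → A ⊗ B` be a graded twisting map with
`τ(y ⊗ x) = a x² ⊗ 1 + b x ⊗ y + c 1 ⊗ y²`.  Write `s_i^d` for the coefficient of `1 ⊗ y^d`
in `τ(y^i ⊗ x^{d-i})`.  If `1 - ac ≠ 0` then `1 - a·s_{d-1}^d ≠ 0` for all `d ≥ 2`. -/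
theorem stmt15 (𝕜 : Type) [Field 𝕜] (a b c : 𝕜)
    (τ : (Polynomial 𝕜) ⊗[𝕜] (Polynomial 𝕜) →ₗ[𝕜] (Polynomial 𝕜) ⊗[𝕜] (Polynomial 𝕜))
    (hτ : IsGradedTwisting 𝕜 (Polynomial 𝕜) (Polynomial 𝕜) (polyGrade 𝕜) (polyGrade 𝕜) τ)
    (hyx : τ ((X : Polynomial 𝕜) ⊗ₜ[𝕜] (X : Polynomial 𝕜)) =
      a • (((X : Polynomial 𝕜) ^ 2) ⊗ₜ[𝕜] (1 : Polynomial 𝕜)) +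
      b • ((X : Polynomial 𝕜) ⊗ₜ[𝕜] (X : Polynomial 𝕜)) +
      c • ((1 : Polynomial 𝕜) ⊗ₜ[𝕜] ((X : Polynomial 𝕜) ^ 2)))
    (h : 1 - a * c ≠ 0) :
    ∀ d : ℕ, 2 ≤ d →
      1 - a * coefAB 𝕜 0 d (τ (((X : Polynomial 𝕜) ^ (d - 1)) ⊗ₜ[𝕜] (X : Polynomial 𝕜))) ≠ 0 := by
  intro d hd
  obtain ⟨n, rfl⟩ := Nat.exists_eq_add_of_le' hd
  refine one_sub_mul_ne_zero_of_rec
    (s := fun n => coefAB 𝕜 0 (n + 2) (τ (((X : Polynomial 𝕜) ^ (n + 1)) ⊗ₜ[𝕜] X)))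
    ?_ (fun n => coefAB_succ hτ hyx (n + 1)) h n
  simp [hyx]

end TTP
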